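/- Let u : (ℝ⁸ × ℝ⁷)∖{(0,0)} → ℝ be u(x,t) = (|x|⁴ + |t|²)^{−5}, where |x|² = Σ_{a=0}^{7} x_a² and |t|² = Σ_{β=1}^{7} t_β². Then u is annihilated by the SubLaplacian of the octonionic Heisenberg group away from the origin: Σ_{a=0}^{7} X_a(X_a u)(x,t) = 0 for all (x,t) ≠ (0,0). (Equivalently, the function C/‖(x,t)‖^{Q−2} with ‖(x,t)‖ = (|x|⁴+|t|²)^{1/4} and Q = 22 is a fundamental solution of the SubLaplacian with singularity only at the origin.) -/

import Mathlib

open scoped BigOperators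
open Matrix

noncomputable section

namespace OC

/-- Octonions, identified with ℝ⁸. -/
abbrev Octo : Type := Fin 8 → ℝ

/-- The seven positively-oriented triples Ω. -/
def OmegaT : List (Fin 8 × Fin 8 × Fin 8) :=
  [(1,2,3),(2,4,6),(4,3,5),(3,6,7),(6,5,1),(5,7,2),(7,1,4)]

/-- The six permutations of a triple, with their signs. -/
def signedPerms3 (t : Fin 8 × Fin 8 × Fin 8) : List (ℝ × (Fin 8 × Fin 8 × Fin 8)) :=
  [(1,(t.1,t.2.1,t.2.2)), (1,(t.2.1,t.2.2,t.1)), (1,(t.2.2,t.1,t.2.1)),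
   (-1,(t.2.1,t.1,t.2.2)), (-1,(t.1,t.2.2,t.2.1)), (-1,(t.2.2,t.2.1,t.1))]

/-- The totally antisymmetric symbol ε with ε(α,β,γ) = 1 on Ω and vanishing on triples
that are not permutations of a triple of Ω. -/
def eps (a b c : Fin 8) : ℝ :=
  (((OmegaT.map signedPerms3).flatten).map (fun p => if p.2 = (a,b,c) then p.1 else 0)).sum

/-- Coefficient of `e d` in the product `e a * e b`: `e 0` is a two-sided unit and
`e α * e β = -δ_{αβ} e 0 + ∑ γ, ε(α,β,γ) e γ` for imaginary indices. -/
def mulCoef (a b d : Fin 8) : ℝ :=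
  if a = 0 then (if d = b then 1 else 0)
  else if b = 0 then (if d = a then 1 else 0)
  else (if a = b ∧ d = 0 then -1 else 0) + eps a b d

/-- Octonion multiplication on ℝ⁸. -/
def omul (x y : Octo) : Octo := fun d => ∑ a, ∑ b, x a * y b * mulCoef a b d

/-- The standard basis octonions e₀,…,e₇. -/
def e (a : Fin 8) : Octo := fun d => if d = a then 1 else 0

/-- Real part. -/
def reO (x : Octo) : ℝ := x 0

/-- Imaginary part. -/
def imO (x : Octo) : Octo := fun d => if d = 0 then 0 else x d

/-- Octonion conjugation. -/
def conjO (x : Octo) : Octo := fun d => if d = 0 then x 0 else -x d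

/-- Squared Euclidean norm |x|². -/
def normSq (x : Octo) : ℝ := ∑ a, (x a)^2

/-- Inverse of a nonzero octonion, q⁻¹ = q̄ / |q|². -/
def oinv (q : Octo) : Octo := (normSq q)⁻¹ • conjO q

/-- The seven quadruples Λ. -/
def LambdaT : List (Fin 8 × Fin 8 × Fin 8 × Fin 8) :=
  [(5,4,6,7),(7,3,5,1),(1,6,7,2),(2,5,1,4),(4,7,2,3),(3,1,4,6),(6,2,5,3)]

/-- The 24 permutations of a quadruple, with their signs. -/
def signedPerms4 (t : Fin 8 × Fin 8 × Fin 8 × Fin 8) :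
    List (ℝ × (Fin 8 × Fin 8 × Fin 8 × Fin 8)) :=
  let a := t.1; let b := t.2.1; let c := t.2.2.1; let d := t.2.2.2
  [ (1,(a,b,c,d)), (-1,(a,b,d,c)), (-1,(a,c,b,d)), (1,(a,c,d,b)), (1,(a,d,b,c)), (-1,(a,d,c,b)),
    (-1,(b,a,c,d)), (1,(b,a,d,c)), (1,(b,c,a,d)), (-1,(b,c,d,a)), (-1,(b,d,a,c)), (1,(b,d,c,a)),
    (1,(c,a,b,d)), (-1,(c,a,d,b)), (-1,(c,b,a,d)), (1,(c,b,d,a)), (1,(c,d,a,b)), (-1,(c,d,b,a)),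
    (-1,(d,a,b,c)), (1,(d,a,c,b)), (1,(d,b,a,c)), (-1,(d,b,c,a)), (-1,(d,c,a,b)), (1,(d,c,b,a)) ]

/-- The totally antisymmetric symbol ε₄ with value 1 on Λ and vanishing on quadruples
that are not permutations of a quadruple of Λ. -/
def eps4 (a b c d : Fin 8) : ℝ :=
  (((LambdaT.map signedPerms4).flatten).map (fun p => if p.2 = (a,b,c,d) then p.1 else 0)).sum

/-- Matrix of left multiplication by `e a`: `(Imat a) d c` is the coefficient of `e d` in
`e a * e c`. -/
def Imat (a : Fin 8) : Matrix (Fin 8) (Fin 8) ℝ := Matrix.of fun d c => mulCoef a c d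

/-- Octonionic Heisenberg group multiplication on 𝕆 × Im 𝕆 (realized inside 𝕆 × 𝕆):
`(x,t)·(y,s) = (x+y, t+s+2 Im(x ȳ))`. -/
def hmul (p q : Octo × Octo) : Octo × Octo :=
  (p.1 + q.1, p.2 + q.2 + (2:ℝ) • imO (omul p.1 (conjO q.1)))

/-- Group inverse in the octonionic Heisenberg group. -/
def hinv (p : Octo × Octo) : Octo × Octo := (-p.1, -p.2)

/-- Homogeneous norm ‖(x,t)‖ = (|x|⁴+|t|²)^{1/4}. -/
def hnorm (p : Octo × Octo) : ℝ := ((normSq p.1)^2 + normSq p.2) ^ ((1:ℝ)/4)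

/-- The inversion R(x,t) = (−((|x|²e₀ − t)⁻¹)x, −t/(|x|⁴+|t|²)). -/
def Rmap (p : Octo × Octo) : Octo × Octo :=
  (-(omul (oinv (normSq p.1 • e 0 - p.2)) p.1),
   -(((normSq p.1)^2 + normSq p.2)⁻¹ • p.2))

/-- E^β = I_β for β ∈ {1,…,7}, indexed here by `Fin 7` via `β ↦ β+1`. -/
def E7 (β : Fin 7) : Matrix (Fin 8) (Fin 8) ℝ := Imat β.succ

/-- Octonionic Heisenberg group multiplication in ℝ⁸ × ℝ⁷ coordinates. -/
def hmulC (p q : (Fin 8 → ℝ) × (Fin 7 → ℝ)) : (Fin 8 → ℝ) × (Fin 7 → ℝ) :=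
  (p.1 + q.1, fun β => p.2 β + q.2 β + 2 * ∑ a, ∑ b, E7 β a b * p.1 a * q.1 b)

/-- The left-invariant horizontal vector fields
`X_a = ∂/∂x_a + 2 ∑_{β,b} (E^β)_{ba} x_b ∂/∂t_β`. -/
def Xop (a : Fin 8) (f : ((Fin 8 → ℝ) × (Fin 7 → ℝ)) → ℝ)
    (p : (Fin 8 → ℝ) × (Fin 7 → ℝ)) : ℝ :=
  fderiv ℝ f p ((Pi.single a 1 : Fin 8 → ℝ), (0 : Fin 7 → ℝ))
    + 2 * ∑ β : Fin 7, ∑ b : Fin 8,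
        E7 β b a * p.1 b * fderiv ℝ f p ((0 : Fin 8 → ℝ), (Pi.single β 1 : Fin 7 → ℝ))

/-- ρ(x,t) = |x|⁴ + |t|². -/
def rho (p : (Fin 8 → ℝ) × (Fin 7 → ℝ)) : ℝ :=
  (∑ a, (p.1 a)^2)^2 + ∑ β, (p.2 β)^2

def epsZ (a b c : Fin 8) : ℤ :=
  (([((1:Fin 8),(2:Fin 8),(3:Fin 8)),(2,4,6),(4,3,5),(3,6,7),(6,5,1),(5,7,2),(7,1,4)]).map
    (fun t => (if (t.1,t.2.1,t.2.2) = (a,b,c) then (1:ℤ) else 0)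
      + (if (t.2.1,t.2.2,t.1) = (a,b,c) then (1:ℤ) else 0)
      + (if (t.2.2,t.1,t.2.1) = (a,b,c) then (1:ℤ) else 0)
      - (if (t.2.1,t.1,t.2.2) = (a,b,c) then (1:ℤ) else 0)
      - (if (t.1,t.2.2,t.2.1) = (a,b,c) then (1:ℤ) else 0)
      - (if (t.2.2,t.2.1,t.1) = (a,b,c) then (1:ℤ) else 0))).sum

lemma eps_cast (a b c : Fin 8) : eps a b c = (epsZ a b c : ℝ) := by
  unfold eps epsZ OmegaT signedPerms3
  simp only [List.map_cons, List.map_nil, List.flatten_cons, List.flatten_nil, List.cons_append,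
    List.nil_append, List.append_nil, List.sum_cons, List.sum_nil]
  push_cast
  have h : ∀ (P : Prop) [Decidable P], (if P then (-1:ℝ) else 0) = -(if P then (1:ℝ) else 0) := by
    intro P _; split_ifs <;> simp
  simp only [h]
  ring

def mulZ (a b d : Fin 8) : ℤ :=
  if a = 0 then (if d = b then 1 else 0)
  else if b = 0 then (if d = a then 1 else 0)
  else (if a = b ∧ d = 0 then -1 else 0) + epsZ a b d

lemma mulCoef_cast (a b d : Fin 8) : mulCoef a b d = (mulZ a b d : ℝ) := by
  unfold mulCoef mulZ
  rw [eps_cast]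
  push_cast
  rfl

/-- Target index and sign of `e_(β+1) e_a`. -/
def tgt : Fin 7 → Fin 8 → Fin 8 := ![
  ![1, 0, 3, 2, 7, 6, 5, 4],
  ![2, 3, 0, 1, 6, 7, 4, 5],
  ![3, 2, 1, 0, 5, 4, 7, 6],
  ![4, 7, 6, 5, 0, 3, 2, 1],
  ![5, 6, 7, 4, 3, 0, 1, 2],
  ![6, 5, 4, 7, 2, 1, 0, 3],
  ![7, 4, 5, 6, 1, 2, 3, 0]]

def sgn : Fin 7 → Fin 8 → ℤ := ![
  ![1, -1, 1, -1, 1, -1, 1, -1],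
  ![1, -1, -1, 1, 1, 1, -1, -1],
  ![1, 1, -1, -1, -1, 1, 1, -1],
  ![1, -1, -1, 1, -1, -1, 1, 1],
  ![1, 1, -1, -1, 1, -1, -1, 1],
  ![1, -1, 1, -1, -1, 1, -1, 1],
  ![1, 1, 1, 1, -1, -1, -1, -1]]

lemma mulZ_table : ∀ (β : Fin 7) (a b : Fin 8),
    mulZ β.succ a b = if b = tgt β a then sgn β a else 0 := by
  decide +kernel

/-- `L β a x = ∑_b E^β_{ba} x_b`. -/
def L (β : Fin 7) (a : Fin 8) (x : Fin 8 → ℝ) : ℝ := ∑ b, E7 β b a * x b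

lemma L_eq (β : Fin 7) (a : Fin 8) (x : Fin 8 → ℝ) : L β a x = sgn β a * x (tgt β a) := by
  unfold L E7 Imat
  simp [mulCoef_cast, mulZ_table]

lemma E7_diag (β : Fin 7) (a : Fin 8) : E7 β a a = 0 := by
  have h : ∀ (β : Fin 7) (a : Fin 8), mulZ β.succ a a = 0 := by decide +kernel
  simp [E7, Imat, mulCoef_cast, h]

def w (a : Fin 8) (p : (Fin 8 → ℝ) × (Fin 7 → ℝ)) : ℝ := ∑ β, L β a p.1 * p.2 β

lemma L_sq (β : Fin 7) (x : Fin 8 → ℝ) : ∑ a, L β a x ^ 2 = ∑ a, x a ^ 2 := by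
  simp only [L_eq, mul_pow]
  fin_cases β <;> simp [tgt, sgn, Fin.sum_univ_eight] <;> ring

lemma x_w (p : (Fin 8 → ℝ) × (Fin 7 → ℝ)) : ∑ a, p.1 a * w a p = 0 := by
  simp [w, L_eq, tgt, sgn, Fin.sum_univ_eight, Fin.sum_univ_seven]
  ring

lemma w_sq (p : (Fin 8 → ℝ) × (Fin 7 → ℝ)) :
    ∑ a, w a p ^ 2 = (∑ a, p.1 a ^ 2) * ∑ β, p.2 β ^ 2 := by
  simp [w, L_eq, tgt, sgn, Fin.sum_univ_eight, Fin.sum_univ_seven]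
  ring

/-- `f` is differentiable at `p` and `X_a f = c` there. -/
def D (a : Fin 8) (p : (Fin 8 → ℝ) × (Fin 7 → ℝ)) (f : ((Fin 8 → ℝ) × (Fin 7 → ℝ)) → ℝ)
    (c : ℝ) : Prop := DifferentiableAt ℝ f p ∧ Xop a f p = c

def V (a : Fin 8) (p : (Fin 8 → ℝ) × (Fin 7 → ℝ)) : (Fin 8 → ℝ) × (Fin 7 → ℝ) :=
  (Pi.single a 1, fun β => 2 * L β a p.1)

lemma Xop_eq (a : Fin 8) (f : ((Fin 8 → ℝ) × (Fin 7 → ℝ)) → ℝ)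
    (p : (Fin 8 → ℝ) × (Fin 7 → ℝ)) : Xop a f p = fderiv ℝ f p (V a p) := by
  have h : V a p = (Pi.single a 1, 0)
      + ∑ β, (2 * L β a p.1) • ((0 : Fin 8 → ℝ), (Pi.single β 1 : Fin 7 → ℝ)) := by
    refine Prod.ext ?_ ?_
    · simp [V, Prod.fst_sum]
    · funext γ
      simp [V, Prod.snd_sum, Finset.sum_apply, Pi.single_apply]
  rw [h, map_add, map_sum]
  simp only [map_smul, smul_eq_mul, Xop, L, Finset.mul_sum, Finset.sum_mul, mul_assoc]

section
variable {a : Fin 8} {p : (Fin 8 → ℝ) × (Fin 7 → ℝ)} {f g : ((Fin 8 → ℝ) × (Fin 7 → ℝ)) → ℝ}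
  {c d : ℝ}

lemma D.of_has {f' : ((Fin 8 → ℝ) × (Fin 7 → ℝ)) →L[ℝ] ℝ} (h : HasFDerivAt f f' p) :
    D a p f (f' (V a p)) := ⟨h.differentiableAt, by rw [Xop_eq, h.fderiv]⟩

lemma D.has (h : D a p f c) : HasFDerivAt f (fderiv ℝ f p) p ∧ fderiv ℝ f p (V a p) = c :=
  ⟨h.1.hasFDerivAt, by rw [← Xop_eq]; exact h.2⟩

lemma D.add (hf : D a p f c) (hg : D a p g d) : D a p (fun q => f q + g q) (c + d) := by
  have h := D.of_has (a := a) (hf.has.1.add hg.has.1)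
  rw [_root_.add_apply, hf.has.2, hg.has.2] at h
  exact h

lemma D.mul (hf : D a p f c) (hg : D a p g d) :
    D a p (fun q => f q * g q) (f p * d + g p * c) := by
  have h := D.of_has (a := a) (hf.has.1.mul hg.has.1)
  simp only [_root_.add_apply, _root_.smul_apply, smul_eq_mul,
    hf.has.2, hg.has.2] at h
  exact h

lemma D.cmul (k : ℝ) (hf : D a p f c) : D a p (fun q => k * f q) (k * c) := by
  have h := D.of_has (a := a) (hf.has.1.const_mul k)
  simp only [_root_.smul_apply, smul_eq_mul, hf.has.2] at h
  exact h

lemma D.sq (hf : D a p f c) : D a p (fun q => f q ^ 2) (2 * f p * c) := by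
  have h := hf.mul hf
  simp only [← pow_two] at h
  convert h using 1
  ring

lemma D.zpow (n : ℤ) (h0 : f p ≠ 0) (hf : D a p f c) :
    D a p (fun q => f q ^ n) (n * f p ^ (n - 1) * c) := by
  have h := D.of_has (a := a) ((hasDerivAt_zpow n (f p) (Or.inl h0)).comp_hasFDerivAt p hf.has.1)
  simp only [_root_.smul_apply, smul_eq_mul, hf.has.2] at h
  exact h

lemma D.sum {ι : Type} [Fintype ι] {F : ι → ((Fin 8 → ℝ) × (Fin 7 → ℝ)) → ℝ} {C : ι → ℝ}
    (h : ∀ i, D a p (F i) (C i)) : D a p (fun q => ∑ i, F i q) (∑ i, C i) := by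
  have h' := D.of_has (a := a) (HasFDerivAt.fun_sum (u := Finset.univ) (fun i _ => (h i).has.1))
  simp only [_root_.sum_apply, fun i => (h i).has.2] at h'
  exact h'

lemma D.x (b : Fin 8) : D a p (fun q => q.1 b) (if b = a then 1 else 0) := by
  have h := D.of_has (a := a) (((ContinuousLinearMap.proj (R := ℝ) (φ := fun _ : Fin 8 => ℝ) b).comp
    (ContinuousLinearMap.fst ℝ (Fin 8 → ℝ) (Fin 7 → ℝ))).hasFDerivAt (x := p))
  simp [V, Pi.single_apply] at h
  exact h

lemma D.t (β : Fin 7) : D a p (fun q => q.2 β) (2 * L β a p.1) := by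
  have h := D.of_has (a := a) (((ContinuousLinearMap.proj (R := ℝ) (φ := fun _ : Fin 7 => ℝ) β).comp
    (ContinuousLinearMap.snd ℝ (Fin 8 → ℝ) (Fin 7 → ℝ))).hasFDerivAt (x := p))
  simp [V] at h
  exact h

lemma D.s : D a p (fun q => ∑ b, q.1 b ^ 2) (2 * p.1 a) := by
  have h := D.sum (fun b : Fin 8 => (D.x (a := a) (p := p) b).sq)
  simpa using h

lemma D.rho : D a p rho (4 * ((∑ b, p.1 b ^ 2) * p.1 a + w a p)) := by
  have h := (D.s (a := a) (p := p)).sq.add (D.sum (fun β : Fin 7 => (D.t (a := a) (p := p) β).sq))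
  refine Eq.subst (motive := fun z => D a p OC.rho z) ?_ h
  symm
  simp only [OC.w, mul_add, Finset.mul_sum]
  congr 1
  · simp only [← Finset.mul_sum]; ring
  · exact Finset.sum_congr rfl fun β _ => by ring

lemma D.L (β : Fin 7) : D a p (fun q => L β a q.1) 0 := by
  have h := D.sum (fun b : Fin 8 => (D.x (a := a) (p := p) b).cmul (E7 β b a))
  simp [E7_diag] at h
  exact h

lemma D.w : D a p (w a) (2 * ∑ β, OC.L β a p.1 ^ 2) := by
  have h := D.sum (fun β : Fin 7 => (D.L (a := a) (p := p) β).mul (D.t (a := a) (p := p) β))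
  refine Eq.subst (motive := fun z => D a p (OC.w a) z) ?_ h
  symm
  rw [Finset.mul_sum]
  exact Finset.sum_congr rfl fun β _ => by ring

end

lemma rho_ne (p : (Fin 8 → ℝ) × (Fin 7 → ℝ)) (hp : p ≠ 0) : rho p ≠ 0 := by
  intro h
  apply hp
  have h1 : 0 ≤ ∑ a, p.1 a ^ 2 := Finset.sum_nonneg fun _ _ => sq_nonneg _
  have h2 : 0 ≤ ∑ β, p.2 β ^ 2 := Finset.sum_nonneg fun _ _ => sq_nonneg _
  unfold rho at h
  have h3 : ∑ a, p.1 a ^ 2 = 0 := by nlinarith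
  have h4 : ∑ β, p.2 β ^ 2 = 0 := by nlinarith
  rw [Finset.sum_eq_zero_iff_of_nonneg fun _ _ => sq_nonneg _] at h3 h4
  refine Prod.ext (funext fun a => ?_) (funext fun β => ?_)
  · simpa using h3 a (Finset.mem_univ _)
  · simpa using h4 β (Finset.mem_univ _)

lemma XX (a : Fin 8) (p : (Fin 8 → ℝ) × (Fin 7 → ℝ)) (hp : p ≠ 0) :
    Xop a (Xop a (fun q => (rho q) ^ (-5 : ℤ))) p =
      rho p ^ (-7 : ℤ) * (480 * ((∑ b, p.1 b ^ 2) * p.1 a + w a p) ^ 2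
        - 20 * rho p * ((∑ b, p.1 b ^ 2) + 2 * p.1 a ^ 2 + 2 * ∑ β, L β a p.1 ^ 2)) := by
  have hr := rho_ne p hp
  have hev : Xop a (fun q => (rho q) ^ (-5 : ℤ)) =ᶠ[nhds p]
      fun q => (-20) * (rho q ^ (-6 : ℤ) * ((∑ b, q.1 b ^ 2) * q.1 a + w a q)) := by
    filter_upwards [isOpen_ne.mem_nhds hp] with q hq
    rw [((D.rho (a := a) (p := q)).zpow (-5) (rho_ne q hq)).2]
    norm_num
    ring
  rw [Xop_eq, hev.fderiv_eq, ← Xop_eq]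
  have h := ((((D.rho (a := a) (p := p)).zpow (-6) hr).mul
    ((D.s.mul (D.x a)).add D.w)).cmul (-20)).2
  rw [h]
  have e6 : rho p ^ (-6 : ℤ) = rho p ^ (-7 : ℤ) * rho p := by
    rw [← zpow_add_one₀ hr]; norm_num
  simp only [e6, if_true]
  norm_num
  ring

/-- u = ρ^{-5} = ‖(x,t)‖^{-(Q-2)} (Q = 22) is annihilated by the
SubLaplacian away from the origin. -/
theorem fundamental_solution (p : (Fin 8 → ℝ) × (Fin 7 → ℝ)) (hp : p ≠ 0) :
    ∑ a : Fin 8, Xop a (Xop a (fun q => (rho q) ^ (-5 : ℤ))) p = 0 := by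
  simp only [XX _ p hp]
  rw [← Finset.mul_sum]
  have hL : ∑ a, ∑ β, L β a p.1 ^ 2 = 7 * ∑ b, p.1 b ^ 2 := by
    rw [Finset.sum_comm]; simp [L_sq]
  have hw := w_sq p
  have hx := x_w p
  have hrho : rho p = (∑ b, p.1 b ^ 2) ^ 2 + ∑ β, p.2 β ^ 2 := rfl
  set s := ∑ b, p.1 b ^ 2 with hs
  have h1 : ∑ a, (s * p.1 a + w a p) ^ 2 = s ^ 2 * s + 2 * s * 0 + s * ∑ β, p.2 β ^ 2 := by
    rw [← hw, ← hx]
    nth_rewrite 3 [hs]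
    rw [Finset.mul_sum, Finset.mul_sum, ← Finset.sum_add_distrib, ← Finset.sum_add_distrib]
    exact Finset.sum_congr rfl fun a _ => by ring
  rw [Finset.sum_sub_distrib, ← Finset.mul_sum, ← Finset.mul_sum, Finset.sum_add_distrib,
    Finset.sum_add_distrib, ← Finset.mul_sum, ← Finset.mul_sum, hL, h1, ← hs, hrho]
  simp only [Finset.sum_const, Finset.card_univ, Fintype.card_fin, nsmul_eq_mul]
  push_cast
  ring

end OC
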